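/- arXiv:1905.00414 — 9 statements merged into one kernel-verified Lean document; each statement's English description precedes it below -/
import Mathlib

section
/- Let X be an n×p real matrix of full column rank and let A be an invertible p×p real matrix. Let X = Q_X·R_X and X·A = Q_{XA}·R_{XA} be decompositions where Q_X and Q_{XA} are n×p real matrices satisfying Q_Xᵀ·Q_X = I_p and Q_{XA}ᵀ·Q_{XA} = I_p, and R_X, R_{XA} are invertible p×p real matrices. Let s be a real-valued function on pairs of real matrices (first argument n×p) that is invariant to orthogonal transformation in its first argument, i.e. s(M·B, Y) = s(M, Y) for every n×p matrix M, every p×p orthogonal matrix B (BᵀB = I_p), and every matrix Y. Then s(Q_X, Y) = s(Q_{XA}, Y) for every Y. Moreover, the matrix B = R_X·A·R_{XA}⁻¹ is orthogonal and satisfies Q_X·B = Q_{XA}. -/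
open Matrix

theorem orthogonalization_invariance (n p m : ℕ)
    (X : Matrix (Fin n) (Fin p) ℝ) (hX : X.rank = p)
    (A : Matrix (Fin p) (Fin p) ℝ) (hA : IsUnit A)
    (QX QXA : Matrix (Fin n) (Fin p) ℝ) (RX RXA : Matrix (Fin p) (Fin p) ℝ)
    (hQRX : X = QX * RX) (hQX : QXᵀ * QX = 1) (hRX : IsUnit RX)
    (hQRXA : X * A = QXA * RXA) (hQXA : QXAᵀ * QXA = 1) (hRXA : IsUnit RXA)
    (s : Matrix (Fin n) (Fin p) ℝ → Matrix (Fin n) (Fin m) ℝ → ℝ)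
    (hs : ∀ (M : Matrix (Fin n) (Fin p) ℝ) (B : Matrix (Fin p) (Fin p) ℝ),
      Bᵀ * B = 1 → ∀ Y : Matrix (Fin n) (Fin m) ℝ, s (M * B) Y = s M Y) :
    (∀ Y : Matrix (Fin n) (Fin m) ℝ, s QX Y = s QXA Y) ∧
    (RX * A * RXA⁻¹)ᵀ * (RX * A * RXA⁻¹) = 1 ∧
    QX * (RX * A * RXA⁻¹) = QXA := by
  have hdet : IsUnit RXA.det := (Matrix.isUnit_iff_isUnit_det _).1 hRXA
  have h3 : QX * (RX * A * RXA⁻¹) = QXA := by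
    rw [← Matrix.mul_assoc, ← Matrix.mul_assoc, ← hQRX, hQRXA,
      Matrix.mul_nonsing_inv_cancel_right _ _ hdet]
  have h2 : (RX * A * RXA⁻¹)ᵀ * (RX * A * RXA⁻¹) = 1 := by
    generalize RX * A * RXA⁻¹ = B at h3
    rw [← h3, Matrix.transpose_mul, Matrix.mul_assoc, ← Matrix.mul_assoc QXᵀ, hQX,
      Matrix.one_mul] at hQXA
    exact hQXA
  refine ⟨fun Y => ?_, h2, h3⟩
  rw [← hs QX _ h2 Y, h3]
end

section
/- Let X be an n×p₁ real matrix and Y an n×p₂ real matrix, each of full column rank, with thin QR decompositions X = Q_X·R_X and Y = Q_Y·R_Y (Q_XᵀQ_X = I_{p₁}, Q_YᵀQ_Y = I_{p₂}, R_X, R_Y invertible). Let Q_Xᵀ·Q_Y = U·Σ·Vᵀ be a full singular value decomposition with U a p₁×p₁ orthogonal matrix, V a p₂×p₂ orthogonal matrix and Σ a p₁×p₂ matrix that is zero off the main diagonal, and set H = Q_X·U. If Xᵀ·H ≠ 0 then ‖Xᵀ·H·Σᵀ‖_F² / ‖Xᵀ·H‖_F² = ‖Q_Yᵀ·X‖_F²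 / ‖X‖_F²; i.e. the modified projection-weighted CCA statistic R²_MPW equals the linear-regression statistic R²_LR. -/
open Matrix

/-- Squared Frobenius norm of a real matrix. -/
noncomputable def frobSq {m n : Type*} [Fintype m] [Fintype n] (A : Matrix m n ℝ) : ℝ :=
  ∑ i, ∑ j, (A i j) ^ 2

theorem frobSq_eq_trace_aux {m n : Type*} [Fintype m] [Fintype n] (A : Matrix m n ℝ) :
    frobSq A = (A * Aᵀ).trace := by
  simp [frobSq, Matrix.trace, Matrix.mul_apply, sq]

theorem frobSq_transpose_aux {m n : Type*} [Fintype m] [Fintype n] (A : Matrix m n ℝ) :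
    frobSq Aᵀ = frobSq A := by
  unfold frobSq
  rw [Finset.sum_comm]
  rfl

theorem frobSq_mul_orth_aux {m n k : Type*} [Fintype m] [Fintype n] [Fintype k] [DecidableEq n]
    (A : Matrix m n ℝ) (W : Matrix n k ℝ) (hW : W * Wᵀ = 1) : frobSq (A * W) = frobSq A := by
  rw [frobSq_eq_trace_aux, frobSq_eq_trace_aux, Matrix.transpose_mul, Matrix.mul_assoc,
    ← Matrix.mul_assoc W, hW, Matrix.one_mul]

theorem modified_pwcca_equals_linear_regression (n p₁ p₂ : ℕ)
    (X : Matrix (Fin n) (Fin p₁) ℝ) (Y : Matrix (Fin n) (Fin p₂) ℝ)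
    (hX : X.rank = p₁) (hY : Y.rank = p₂)
    (QX : Matrix (Fin n) (Fin p₁) ℝ) (RX : Matrix (Fin p₁) (Fin p₁) ℝ)
    (QY : Matrix (Fin n) (Fin p₂) ℝ) (RY : Matrix (Fin p₂) (Fin p₂) ℝ)
    (hQRX : X = QX * RX) (hQX : QXᵀ * QX = 1) (hRX : IsUnit RX)
    (hQRY : Y = QY * RY) (hQY : QYᵀ * QY = 1) (hRY : IsUnit RY)
    (U : Matrix (Fin p₁) (Fin p₁) ℝ) (Sig : Matrix (Fin p₁) (Fin p₂) ℝ)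
    (V : Matrix (Fin p₂) (Fin p₂) ℝ)
    (hU : Uᵀ * U = 1) (hV : Vᵀ * V = 1)
    (hSig : ∀ (i : Fin p₁) (j : Fin p₂), (i : ℕ) ≠ (j : ℕ) → Sig i j = 0)
    (hSVD : QXᵀ * QY = U * Sig * Vᵀ)
    (H : Matrix (Fin n) (Fin p₁) ℝ) (hH : H = QX * U)
    (hXH : Xᵀ * H ≠ 0) :
    frobSq (Xᵀ * H * Sig) / frobSq (Xᵀ * H) = frobSq (QYᵀ * X) / frobSq X := by
  have hXQ : Xᵀ * QX = RXᵀ := by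
    rw [hQRX, Matrix.transpose_mul, Matrix.mul_assoc, hQX, Matrix.mul_one]
  have hXt : Xᵀ = RXᵀ * QXᵀ := by rw [hQRX, Matrix.transpose_mul]
  have hUS : U * Sig = QXᵀ * QY * V := by
    rw [hSVD, Matrix.mul_assoc, hV, Matrix.mul_one]
  have h1 : Xᵀ * H * Sig = (Xᵀ * QY) * V := by
    rw [hH, ← Matrix.mul_assoc, hXQ, Matrix.mul_assoc, hUS, hXt]
    simp only [Matrix.mul_assoc]
  have h2 : Xᵀ * H = RXᵀ * U := by rw [hH, ← Matrix.mul_assoc, hXQ]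
  have h3 : frobSq (Xᵀ * H * Sig) = frobSq (QYᵀ * X) := by
    rw [h1, frobSq_mul_orth_aux _ _ (by rw [mul_eq_one_comm]; exact hV),
      ← frobSq_transpose_aux, Matrix.transpose_mul, Matrix.transpose_transpose]
  have h4 : frobSq (Xᵀ * H) = frobSq X := by
    rw [h2, frobSq_mul_orth_aux _ _ (by rw [mul_eq_one_comm]; exact hU),
      ← frobSq_transpose_aux X, hXt, frobSq_mul_orth_aux _ _ (by simpa using hQX)]
  rw [h3, h4]
end

section
/- Let X be an n×p₁ real matrix and Y an n×p₂ real matrix. Let (λ_X^i, u_X^i)_{i=1}^{n} be the eigenvalues and a corresponding orthonormal eigenbasis of the symmetric matrix X·Xᵀ, and (λ_Y^j, u_Y^j)_{j=1}^{n} likewise for Y·Yᵀ. Then ‖Yᵀ·X‖_F² = Σ_{i=1}^{n} Σ_{j=1}^{n} λ_X^i·λ_Y^j·⟨u_X^i, u_Y^j⟩². Consequently, if X ≠ 0 and Y ≠ 0, the linear centered kernel alignment CKA(X·Xᵀ, Y·Yᵀ) = ‖Yᵀ·X‖_F²/(‖Xᵀ·X‖_F·‖Yᵀ·Y‖_F)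 equals (Σ_{i,j} λ_X^i·λ_Y^j·⟨u_X^i, u_Y^j⟩²) / (√(Σ_i (λ_X^i)²)·√(Σ_j (λ_Y^j)²)). -/
open Matrix

/-- Frobenius norm of a real matrix. -/
noncomputable def frobNorm {m n : Type*} [Fintype m] [Fintype n] (A : Matrix m n ℝ) : ℝ :=
  Real.sqrt (frobSq A)

theorem eig_decomp_aux {n : ℕ} (A : Matrix (Fin n) (Fin n) ℝ) (l : Fin n → ℝ)
    (u : Fin n → (Fin n → ℝ)) (hE : ∀ i, A *ᵥ u i = l i • u i)
    (hO : ∀ i j, (∑ k, u i k * u j k) = if i = j then (1 : ℝ) else 0) :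
    A = (Matrix.of u)ᵀ * Matrix.diagonal l * Matrix.of u := by
  have h1 : Matrix.of u * (Matrix.of u)ᵀ = 1 := by
    ext i j
    simp [Matrix.mul_apply, Matrix.one_apply, hO]
  have h2 : (Matrix.of u)ᵀ * Matrix.of u = 1 := mul_eq_one_comm.mp h1
  have h3 : A * (Matrix.of u)ᵀ = (Matrix.of u)ᵀ * Matrix.diagonal l := by
    ext k i
    have := congrFun (hE i) k
    rw [Matrix.mul_diagonal]
    simpa [Matrix.mul_apply, Matrix.mulVec, dotProduct, mul_comm] using this
  rw [← h3, Matrix.mul_assoc, h2, Matrix.mul_one]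

theorem frobSq_aux {n p₁ p₂ : ℕ}
    (X : Matrix (Fin n) (Fin p₁) ℝ) (Y : Matrix (Fin n) (Fin p₂) ℝ)
    (lamX lamY : Fin n → ℝ) (uX uY : Fin n → (Fin n → ℝ))
    (hEigX : ∀ i, (X * Xᵀ) *ᵥ uX i = lamX i • uX i)
    (hEigY : ∀ j, (Y * Yᵀ) *ᵥ uY j = lamY j • uY j)
    (hONX : ∀ i j, (∑ k, uX i k * uX j k) = if i = j then (1 : ℝ) else 0)
    (hONY : ∀ i j, (∑ k, uY i k * uY j k) = if i = j then (1 : ℝ) else 0) :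
    frobSq (Yᵀ * X) = ∑ i, ∑ j, lamX i * lamY j * (∑ k, uX i k * uY j k) ^ 2 := by
  have hx := eig_decomp_aux _ lamX uX hEigX hONX
  have hy := eig_decomp_aux _ lamY uY hEigY hONY
  have h1 : frobSq (Yᵀ * X) = Matrix.trace ((Yᵀ * X) * (Yᵀ * X)ᵀ) := by
    generalize Yᵀ * X = M
    simp [frobSq, Matrix.trace, Matrix.mul_apply, pow_two]
  have h2 : Matrix.trace ((Yᵀ * X) * (Yᵀ * X)ᵀ) = Matrix.trace ((X * Xᵀ) * (Y * Yᵀ)) := by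
    rw [Matrix.transpose_mul, Matrix.transpose_transpose, Matrix.mul_assoc, Matrix.trace_mul_comm]
    simp only [Matrix.mul_assoc]
  have h3 : Matrix.trace ((X * Xᵀ) * (Y * Yᵀ)) =
      Matrix.trace (Matrix.diagonal lamX * (Matrix.of uX * (Matrix.of uY)ᵀ) *
        (Matrix.diagonal lamY * (Matrix.of uX * (Matrix.of uY)ᵀ)ᵀ)) := by
    rw [hx, hy, Matrix.transpose_mul, Matrix.transpose_transpose, Matrix.mul_assoc,
      Matrix.mul_assoc, Matrix.trace_mul_comm]
    simp only [Matrix.mul_assoc]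
  rw [h1, h2, h3]
  have hW : ∀ i j, (Matrix.of uX * (Matrix.of uY)ᵀ) i j = ∑ k, uX i k * uY j k := by
    intro i j
    simp [Matrix.mul_apply]
  generalize (Matrix.of uX * (Matrix.of uY)ᵀ) = W at hW
  simp only [← hW, Matrix.trace, Matrix.diag_apply]
  refine Finset.sum_congr rfl fun i _ => ?_
  rw [Matrix.mul_apply]
  refine Finset.sum_congr rfl fun j _ => ?_
  rw [Matrix.diagonal_mul, Matrix.diagonal_mul, Matrix.transpose_apply]
  ring

theorem frobNorm_aux {n p : ℕ} (X : Matrix (Fin n) (Fin p) ℝ)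
    (l : Fin n → ℝ) (u : Fin n → (Fin n → ℝ))
    (hE : ∀ i, (X * Xᵀ) *ᵥ u i = l i • u i)
    (hO : ∀ i j, (∑ k, u i k * u j k) = if i = j then (1 : ℝ) else 0) :
    frobNorm (Xᵀ * X) = Real.sqrt (∑ i, (l i) ^ 2) := by
  rw [frobNorm, frobSq_aux X X l l u u hE hE hO hO]
  simp [hO, pow_two]

theorem linear_cka_eigendecomposition (n p₁ p₂ : ℕ)
    (X : Matrix (Fin n) (Fin p₁) ℝ) (Y : Matrix (Fin n) (Fin p₂) ℝ)
    (lamX lamY : Fin n → ℝ) (uX uY : Fin n → (Fin n → ℝ))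
    (hEigX : ∀ i, (X * Xᵀ) *ᵥ uX i = lamX i • uX i)
    (hEigY : ∀ j, (Y * Yᵀ) *ᵥ uY j = lamY j • uY j)
    (hONX : ∀ i j, (∑ k, uX i k * uX j k) = if i = j then (1 : ℝ) else 0)
    (hONY : ∀ i j, (∑ k, uY i k * uY j k) = if i = j then (1 : ℝ) else 0)
    (hX : X ≠ 0) (hY : Y ≠ 0) :
    frobSq (Yᵀ * X) = ∑ i, ∑ j, lamX i * lamY j * (∑ k, uX i k * uY j k) ^ 2 ∧
    frobSq (Yᵀ * X) / (frobNorm (Xᵀ * X) * frobNorm (Yᵀ * Y)) =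
      (∑ i, ∑ j, lamX i * lamY j * (∑ k, uX i k * uY j k) ^ 2) /
        (Real.sqrt (∑ i, (lamX i) ^ 2) * Real.sqrt (∑ j, (lamY j) ^ 2)) := by
  have h := frobSq_aux X Y lamX lamY uX uY hEigX hEigY hONX hONY
  refine ⟨h, ?_⟩
  rw [h, frobNorm_aux X lamX uX hEigX hONX, frobNorm_aux Y lamY uY hEigY hONY]
end

section
/- Let X be a nonzero n×p₁ real matrix and Q_Y an n×p₂ real matrix with Q_YᵀQ_Y = I_{p₂}, p₂ > 0. Then ‖Q_Yᵀ·X‖_F²/‖X‖_F² = [‖Q_Yᵀ·X‖_F²/(‖Xᵀ·X‖_F·‖Q_Yᵀ·Q_Y‖_F)]·(√(p₂)·‖Xᵀ·X‖_F/‖X‖_F²); that is, R²_LR = CKA(X·Xᵀ, Q_Y·Q_Yᵀ)·√(p₂)·‖Xᵀ·X‖_F/‖X‖_F². -/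
open Matrix

theorem frobSq_pos_of_ne_zero {m n : Type*} [Fintype m] [Fintype n] (A : Matrix m n ℝ)
    (hA : A ≠ 0) : 0 < frobSq A := by
  have h : ∃ i j, A i j ≠ 0 := by
    by_contra hc
    push Not at hc
    exact hA (by ext i j; exact hc i j)
  obtain ⟨i, j, hij⟩ := h
  unfold frobSq
  refine Finset.sum_pos' (fun i _ => Finset.sum_nonneg fun j _ => sq_nonneg _)
    ⟨i, Finset.mem_univ _, ?_⟩
  exact Finset.sum_pos' (fun j _ => sq_nonneg _) ⟨j, Finset.mem_univ _, by positivity⟩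

theorem r2lr_eq_cka_relation (n p₁ p₂ : ℕ) (hp₂ : 0 < p₂)
    (X : Matrix (Fin n) (Fin p₁) ℝ) (hX : X ≠ 0)
    (QY : Matrix (Fin n) (Fin p₂) ℝ) (hQY : QYᵀ * QY = 1) :
    frobSq (QYᵀ * X) / frobSq X =
      frobSq (QYᵀ * X) / (frobNorm (Xᵀ * X) * frobNorm (QYᵀ * QY)) *
        (Real.sqrt (p₂ : ℝ) * frobNorm (Xᵀ * X) / frobSq X) := by
  have h1 : frobNorm (QYᵀ * QY) = Real.sqrt (p₂ : ℝ) := by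
    rw [hQY]
    unfold frobNorm frobSq
    congr 1
    simp [Matrix.one_apply]
  have h2 : Xᵀ * X ≠ 0 := by
    intro h
    apply hX
    have h' : Xᴴ * X = 0 := by rw [Matrix.conjTranspose_eq_transpose_of_trivial]; exact h
    exact Matrix.conjTranspose_mul_self_eq_zero.mp h'
  have h3 : 0 < frobNorm (Xᵀ * X) := Real.sqrt_pos.mpr (frobSq_pos_of_ne_zero _ h2)
  have h4 : 0 < Real.sqrt (p₂ : ℝ) := Real.sqrt_pos.mpr (by exact_mod_cast hp₂)
  have h5 := frobSq_pos_of_ne_zero X hX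
  rw [h1]
  field_simp
end

section
/- With X, Y, κ_X, κ_Y, Q̃_X, Q̃_Y, λ_X^i, λ_Y^j as in the canonical ridge setting and p₁ ≤ p₂, the sum of the squared singular values of Q̃_Yᵀ·Q̃_X satisfies ‖Q̃_Yᵀ·Q̃_X‖_F² ≤ √(Σ_{i=1}^{p₁} (λ_X^i/(λ_X^i + κ_X))²) · √(Σ_{j=1}^{p₂} (λ_Y^j/(λ_Y^j + κ_Y))²). -/
open Matrix

theorem bessel_aux {m k : ℕ} (U : Matrix (Fin m) (Fin k) ℝ) (hU : Uᵀ * U = 1)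
    (v : Fin m → ℝ) : (∑ j, ((Uᵀ *ᵥ v) j) ^ 2) ≤ v ⬝ᵥ v := by
  have h0 : 0 ≤ (v - U *ᵥ (Uᵀ *ᵥ v)) ⬝ᵥ (v - U *ᵥ (Uᵀ *ᵥ v)) :=
    Finset.sum_nonneg fun i _ => mul_self_nonneg _
  have e1 : v ⬝ᵥ (U *ᵥ (Uᵀ *ᵥ v)) = (Uᵀ *ᵥ v) ⬝ᵥ (Uᵀ *ᵥ v) := by
    rw [Matrix.dotProduct_mulVec, ← Matrix.mulVec_transpose]
  have e2 : (U *ᵥ (Uᵀ *ᵥ v)) ⬝ᵥ (U *ᵥ (Uᵀ *ᵥ v)) = (Uᵀ *ᵥ v) ⬝ᵥ (Uᵀ *ᵥ v) := by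
    rw [Matrix.dotProduct_mulVec, ← Matrix.mulVec_transpose, Matrix.mulVec_mulVec, hU,
      Matrix.one_mulVec]
  rw [sub_dotProduct, dotProduct_sub, dotProduct_sub, e2, dotProduct_comm (U *ᵥ _) v, e1] at h0
  have e3 : (∑ j, ((Uᵀ *ᵥ v) j) ^ 2) = (Uᵀ *ᵥ v) ⬝ᵥ (Uᵀ *ᵥ v) := by
    simp only [dotProduct, sq]
  rw [e3]; linarith

theorem col_aux {m k l : ℕ} (U : Matrix (Fin m) (Fin k) ℝ) (W : Matrix (Fin m) (Fin l) ℝ)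
    (hU : Uᵀ * U = 1) (hW : Wᵀ * W = 1) (i : Fin l) :
    (∑ j, ((Uᵀ * W) j i) ^ 2) ≤ 1 := by
  have h := bessel_aux U hU (fun r => W r i)
  have e : (fun r => W r i) ⬝ᵥ (fun r => W r i) = 1 := by
    have := congrFun (congrFun hW i) i
    simpa [Matrix.mul_apply, dotProduct] using this
  rw [e] at h
  exact h

theorem canonical_ridge_cauchy_schwarz_bound (n p₁ p₂ : ℕ) (hp : p₁ ≤ p₂)
    (X : Matrix (Fin n) (Fin p₁) ℝ) (Y : Matrix (Fin n) (Fin p₂) ℝ)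
    (UX : Matrix (Fin n) (Fin p₁) ℝ) (σX : Fin p₁ → ℝ) (VX : Matrix (Fin p₁) (Fin p₁) ℝ)
    (UY : Matrix (Fin n) (Fin p₂) ℝ) (σY : Fin p₂ → ℝ) (VY : Matrix (Fin p₂) (Fin p₂) ℝ)
    (hUX : UXᵀ * UX = 1) (hUY : UYᵀ * UY = 1)
    (hVX : VXᵀ * VX = 1) (hVY : VYᵀ * VY = 1)
    (hσX : ∀ i, 0 ≤ σX i) (hσY : ∀ j, 0 ≤ σY j)
    (hSVDX : X = UX * Matrix.diagonal σX * VXᵀ)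
    (hSVDY : Y = UY * Matrix.diagonal σY * VYᵀ)
    (κX κY : ℝ) (hκX : 0 < κX) (hκY : 0 < κY)
    (QtX : Matrix (Fin n) (Fin p₁) ℝ) (QtY : Matrix (Fin n) (Fin p₂) ℝ)
    (hQtX : QtX = UX * Matrix.diagonal σX *
      Matrix.diagonal (fun i => (Real.sqrt (σX i ^ 2 + κX))⁻¹))
    (hQtY : QtY = UY * Matrix.diagonal σY *
      Matrix.diagonal (fun j => (Real.sqrt (σY j ^ 2 + κY))⁻¹)) :
    frobSq (QtYᵀ * QtX) ≤
      Real.sqrt (∑ i : Fin p₁, (σX i ^ 2 / (σX i ^ 2 + κX)) ^ 2) *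
        Real.sqrt (∑ j : Fin p₂, (σY j ^ 2 / (σY j ^ 2 + κY)) ^ 2) := by
  have sqa : ∀ s κ : ℝ, 0 < κ → (s * (Real.sqrt (s ^ 2 + κ))⁻¹) ^ 2 = s ^ 2 / (s ^ 2 + κ) := by
    intro s κ h
    rw [mul_pow, inv_pow, Real.sq_sqrt (by positivity), div_eq_mul_inv]
  have hM : ∀ j i, ((QtYᵀ * QtX) j i) ^ 2 = (UYᵀ * UX) j i ^ 2 *
      ((σY j ^ 2 / (σY j ^ 2 + κY)) * (σX i ^ 2 / (σX i ^ 2 + κX))) := by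
    intro j i
    rw [← sqa _ _ hκX, ← sqa _ _ hκY, ← mul_pow, ← mul_pow]
    congr 1
    rw [hQtX, hQtY]
    rw [Matrix.mul_apply, Matrix.mul_apply, Finset.sum_mul]
    simp only [Matrix.transpose_apply, Matrix.mul_diagonal]
    exact Finset.sum_congr rfl fun _ _ => by ring
  have hc := fun i => col_aux UY UX hUY hUX i
  have hr : ∀ j, (∑ i, ((UYᵀ * UX) j i) ^ 2) ≤ 1 := by
    intro j
    have h := col_aux UX UY hUX hUY j
    have e : UXᵀ * UY = (UYᵀ * UX)ᵀ := by simp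
    rw [e] at h
    exact h
  unfold frobSq
  simp only [hM]
  generalize UYᵀ * UX = M at hc hr
  set a : Fin p₁ → ℝ := fun i => σX i ^ 2 / (σX i ^ 2 + κX) with ha
  set b : Fin p₂ → ℝ := fun j => σY j ^ 2 / (σY j ^ 2 + κY) with hb
  change (∑ j, ∑ i, M j i ^ 2 * (b j * a i)) ≤ √(∑ i, a i ^ 2) * √(∑ j, b j ^ 2)
  have cs := Real.sum_mul_le_sqrt_mul_sqrt (Finset.univ : Finset (Fin p₂ × Fin p₁))
    (fun x => M x.1 x.2 * a x.2) (fun x => M x.1 x.2 * b x.1)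
  rw [Fintype.sum_prod_type, Fintype.sum_prod_type_right, Fintype.sum_prod_type] at cs
  refine le_trans (le_of_eq ?_) (cs.trans ?_)
  · exact Finset.sum_congr rfl fun _ _ => Finset.sum_congr rfl fun _ _ => by ring
  · apply mul_le_mul _ _ (Real.sqrt_nonneg _) (Real.sqrt_nonneg _)
    · apply Real.sqrt_le_sqrt
      refine Finset.sum_le_sum fun i _ => ?_
      simp only [mul_pow, ← Finset.sum_mul]
      exact mul_le_of_le_one_left (sq_nonneg _) (hc i)
    · apply Real.sqrt_le_sqrt
      refine Finset.sum_le_sum fun j _ => ?_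
      simp only [mul_pow, ← Finset.sum_mul]
      exact mul_le_of_le_one_left (sq_nonneg _) (hr j)
end

section
/- Let X be an n×p₁ real matrix of full column rank and Y an n×p₂ real matrix of full column rank, with thin SVDs X = U_X·Σ_X·V_Xᵀ and Y = U_Y·Σ_Y·V_Yᵀ, and write λ_X^i = (Σ_X)_{ii}² > 0, λ_Y^j = (Σ_Y)_{jj}² > 0, with u_X^i, u_Y^j the columns of U_X, U_Y. Assume p₁ ≤ p₂ and X ≠ 0. Then, as κ_X → ∞, the ratio [Σ_{i=1}^{p₁} Σ_{j=1}^{p₂} (λ_X^i·λ_Y^j / ((λ_X^i + κ_X)·λ_Y^j))·⟨u_X^i, u_Y^j⟩²] / [Σ_{i=1}^{p₁} λ_X^i·λ_Y^i/((λ_X^i + κ_X)·λ_Y^i)] tends to Σ_{i=1}^{p₁} Σ_{j=1}^{p₂} λ_X^i·⟨u_X^i, u_Y^j⟩² / Σ_{i=1}^{p₁} λ_X^i, and this limit equals ‖U_Yᵀ·X‖_F²/‖X‖_F², the linear-regression statistic R²_LR for regressing X on Y. -/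
open Matrix

theorem frobSq_mul_transpose_aux {m n : Type*} [Fintype m] [Fintype n] [DecidableEq n]
    (A : Matrix m n ℝ) (V : Matrix n n ℝ) (hV : Vᵀ * V = 1) :
    frobSq (A * Vᵀ) = frobSq A := by
  have key : ∀ B : Matrix m n ℝ, frobSq B = (B * Bᵀ).trace := by
    intro B
    simp [frobSq, Matrix.trace, Matrix.mul_apply, sq]
  rw [key, key, Matrix.transpose_mul, Matrix.transpose_transpose, Matrix.mul_assoc,
    ← Matrix.mul_assoc Vᵀ, hV, Matrix.one_mul]

theorem canonical_ridge_limit_linear_regression (n p₁ p₂ : ℕ) (hp : p₁ ≤ p₂)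
    (X : Matrix (Fin n) (Fin p₁) ℝ) (Y : Matrix (Fin n) (Fin p₂) ℝ)
    (hrX : X.rank = p₁) (hrY : Y.rank = p₂) (hXne : X ≠ 0)
    (UX : Matrix (Fin n) (Fin p₁) ℝ) (σX : Fin p₁ → ℝ) (VX : Matrix (Fin p₁) (Fin p₁) ℝ)
    (UY : Matrix (Fin n) (Fin p₂) ℝ) (σY : Fin p₂ → ℝ) (VY : Matrix (Fin p₂) (Fin p₂) ℝ)
    (hUX : UXᵀ * UX = 1) (hUY : UYᵀ * UY = 1)
    (hVX : VXᵀ * VX = 1) (hVY : VYᵀ * VY = 1)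
    (hσX : ∀ i, 0 < σX i ^ 2) (hσY : ∀ j, 0 < σY j ^ 2)
    (hSVDX : X = UX * Matrix.diagonal σX * VXᵀ)
    (hSVDY : Y = UY * Matrix.diagonal σY * VYᵀ) :
    Filter.Tendsto (fun κX : ℝ =>
        (∑ i : Fin p₁, ∑ j : Fin p₂,
            σX i ^ 2 * σY j ^ 2 / ((σX i ^ 2 + κX) * σY j ^ 2) *
              (∑ k, UX k i * UY k j) ^ 2) /
          (∑ i : Fin p₁,
            σX i ^ 2 * σY (Fin.castLE hp i) ^ 2 /
              ((σX i ^ 2 + κX) * σY (Fin.castLE hp i) ^ 2)))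
      Filter.atTop
      (nhds ((∑ i : Fin p₁, ∑ j : Fin p₂, σX i ^ 2 * (∑ k, UX k i * UY k j) ^ 2) /
        (∑ i : Fin p₁, σX i ^ 2))) ∧
    (∑ i : Fin p₁, ∑ j : Fin p₂, σX i ^ 2 * (∑ k, UX k i * UY k j) ^ 2) /
        (∑ i : Fin p₁, σX i ^ 2) =
      frobSq (UYᵀ * X) / frobSq X := by
  have hp1 : Nonempty (Fin p₁) := by
    by_contra h
    rw [not_nonempty_iff] at h
    exact hXne (by ext i j; exact h.elim j)
  have hpos : 0 < ∑ i : Fin p₁, σX i ^ 2 :=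
    Finset.sum_pos (fun i _ => hσX i) Finset.univ_nonempty
  constructor
  · have hlim : ∀ i : Fin p₁, Filter.Tendsto (fun κ : ℝ => κ * (σX i ^ 2 / (σX i ^ 2 + κ)))
        Filter.atTop (nhds (σX i ^ 2)) := by
      intro i
      have h1 : Filter.Tendsto (fun κ : ℝ => σX i ^ 2 - (σX i ^ 2 * σX i ^ 2) / (σX i ^ 2 + κ))
          Filter.atTop (nhds (σX i ^ 2 - 0)) :=
        tendsto_const_nhds.sub (Filter.Tendsto.const_div_atTop
          (Filter.tendsto_atTop_add_const_left _ _ Filter.tendsto_id) _)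
      rw [sub_zero] at h1
      refine h1.congr' ?_
      filter_upwards [Filter.eventually_gt_atTop (0 : ℝ)] with κ hκ
      have := hσX i
      have h2 : σX i ^ 2 + κ ≠ 0 := by positivity
      field_simp
      ring
    have hN : Filter.Tendsto (fun κ : ℝ => ∑ i : Fin p₁, ∑ j : Fin p₂,
        κ * (σX i ^ 2 / (σX i ^ 2 + κ)) * (∑ k, UX k i * UY k j) ^ 2) Filter.atTop
        (nhds (∑ i : Fin p₁, ∑ j : Fin p₂, σX i ^ 2 * (∑ k, UX k i * UY k j) ^ 2)) :=
      tendsto_finsetSum _ fun i _ => tendsto_finsetSum _ fun j _ => (hlim i).mul_const _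
    have hD : Filter.Tendsto (fun κ : ℝ => ∑ i : Fin p₁,
        κ * (σX i ^ 2 / (σX i ^ 2 + κ))) Filter.atTop (nhds (∑ i : Fin p₁, σX i ^ 2)) :=
      tendsto_finsetSum _ fun i _ => hlim i
    refine (hN.div hD hpos.ne').congr' ?_
    filter_upwards [Filter.eventually_gt_atTop (0 : ℝ)] with κ hκ
    have e : ∀ (i : Fin p₁) (j : Fin p₂),
        σX i ^ 2 * σY j ^ 2 / ((σX i ^ 2 + κ) * σY j ^ 2) = σX i ^ 2 / (σX i ^ 2 + κ) :=
      fun i j => mul_div_mul_right _ _ (hσY j).ne'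
    simp only [e, Pi.div_apply, mul_assoc, ← Finset.mul_sum]
    exact mul_div_mul_left _ _ hκ.ne'
  · have hX : frobSq X = ∑ i : Fin p₁, σX i ^ 2 := by
      rw [hSVDX, frobSq_mul_transpose_aux _ _ hVX]
      unfold frobSq
      rw [Finset.sum_comm]
      refine Finset.sum_congr rfl fun i _ => ?_
      have h := congrFun (congrFun hUX i) i
      simp only [Matrix.mul_apply, Matrix.transpose_apply, Matrix.one_apply_eq] at h
      simp only [Matrix.mul_diagonal, mul_pow, ← Finset.sum_mul]
      simp only [sq] at h ⊢
      rw [h, one_mul]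
    have hYX : frobSq (UYᵀ * X) =
        ∑ i : Fin p₁, ∑ j : Fin p₂, σX i ^ 2 * (∑ k, UX k i * UY k j) ^ 2 := by
      rw [hSVDX, ← Matrix.mul_assoc, frobSq_mul_transpose_aux _ _ hVX, ← Matrix.mul_assoc]
      unfold frobSq
      rw [Finset.sum_comm]
      refine Finset.sum_congr rfl fun i _ => Finset.sum_congr rfl fun j _ => ?_
      rw [Matrix.mul_diagonal, mul_pow]
      simp only [Matrix.mul_apply, Matrix.transpose_apply]
      rw [mul_comm]
      simp only [mul_comm (UY _ _)]
    rw [hX, hYX]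
end

section
/- Let X be a nonzero n×p₁ real matrix and Y a nonzero n×p₂ real matrix with thin SVDs X = U_X·Σ_X·V_Xᵀ and Y = U_Y·Σ_Y·V_Yᵀ, λ_X^i = (Σ_X)_{ii}², λ_Y^j = (Σ_Y)_{jj}², and u_X^i, u_Y^j the columns of U_X, U_Y. Then, as κ → ∞, the ratio [Σ_{i=1}^{p₁} Σ_{j=1}^{p₂} (λ_X^i·λ_Y^j/((λ_X^i + κ)·(λ_Y^j + κ)))·⟨u_X^i, u_Y^j⟩²] / [√(Σ_{i=1}^{p₁} (λ_X^i/(λ_X^i + κ))²)·√(Σ_{j=1}^{p₂} (λ_Y^j/(λ_Y^j + κ))²)] tends to (Σ_{i,j} λ_X^i·λ_Y^j·⟨u_X^i, u_Y^j⟩²)/(√(Σ_i (λ_X^i)²)·√(Σ_j (λ_Y^j)²)), which equals the linear centered kernel alignment CKA(X·Xᵀ, Y·Yᵀ) = ‖Yᵀ·X‖_F²/(‖Xᵀ·X‖_F·‖Yᵀ·Y‖_F). -/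
open Matrix

lemma frobSq_eq_trace {m n : Type*} [Fintype m] [Fintype n] (A : Matrix m n ℝ) :
    frobSq A = (Aᵀ * A).trace := by
  simp only [frobSq, Matrix.trace, Matrix.diag, Matrix.mul_apply, Matrix.transpose_apply]
  rw [Finset.sum_comm]
  simp only [sq]

lemma frobSq_orth {m n : ℕ} (V : Matrix (Fin m) (Fin m) ℝ) (W : Matrix (Fin n) (Fin n) ℝ)
    (A : Matrix (Fin m) (Fin n) ℝ) (hV : Vᵀ * V = 1) (hW : Wᵀ * W = 1) :
    frobSq (V * A * Wᵀ) = frobSq A := by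
  rw [frobSq_eq_trace, frobSq_eq_trace]
  have h : (V * A * Wᵀ)ᵀ * (V * A * Wᵀ) = W * (Aᵀ * A * Wᵀ) := by
    simp only [Matrix.transpose_mul, Matrix.transpose_transpose, Matrix.mul_assoc]
    rw [← Matrix.mul_assoc Vᵀ V, hV, Matrix.one_mul]
  rw [h, Matrix.trace_mul_comm, Matrix.mul_assoc, hW, Matrix.mul_one]

lemma frobSq_gram {n p : ℕ} (U : Matrix (Fin n) (Fin p) ℝ) (σ : Fin p → ℝ)
    (V : Matrix (Fin p) (Fin p) ℝ) (hU : Uᵀ * U = 1) (hV : Vᵀ * V = 1) :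
    frobSq ((U * Matrix.diagonal σ * Vᵀ)ᵀ * (U * Matrix.diagonal σ * Vᵀ))
      = ∑ i, (σ i ^ 2) ^ 2 := by
  have h : (U * Matrix.diagonal σ * Vᵀ)ᵀ * (U * Matrix.diagonal σ * Vᵀ)
      = V * (Matrix.diagonal σ * Matrix.diagonal σ) * Vᵀ := by
    simp only [Matrix.transpose_mul, Matrix.transpose_transpose, Matrix.mul_assoc,
      Matrix.diagonal_transpose]
    rw [← Matrix.mul_assoc Uᵀ U, hU, Matrix.one_mul]
  rw [h, frobSq_orth _ _ _ hV hV, Matrix.diagonal_mul_diagonal]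
  simp only [frobSq, Matrix.diagonal_apply]
  refine Finset.sum_congr rfl fun i _ => ?_
  rw [Finset.sum_eq_single i]
  · simp [sq]
  · intro b _ hb
    simp [hb.symm]
  · simp

lemma frobSq_cross {n p q : ℕ} (U : Matrix (Fin n) (Fin p) ℝ) (σ : Fin p → ℝ)
    (V : Matrix (Fin p) (Fin p) ℝ) (hV : Vᵀ * V = 1)
    (U' : Matrix (Fin n) (Fin q) ℝ) (τ : Fin q → ℝ)
    (W : Matrix (Fin q) (Fin q) ℝ) (hW : Wᵀ * W = 1) :
    frobSq ((U' * Matrix.diagonal τ * Wᵀ)ᵀ * (U * Matrix.diagonal σ * Vᵀ))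
      = ∑ i, ∑ j, σ i ^ 2 * τ j ^ 2 * (∑ k, U k i * U' k j) ^ 2 := by
  have h : (U' * Matrix.diagonal τ * Wᵀ)ᵀ * (U * Matrix.diagonal σ * Vᵀ)
      = W * (Matrix.diagonal τ * (U'ᵀ * U) * Matrix.diagonal σ) * Vᵀ := by
    simp only [Matrix.transpose_mul, Matrix.transpose_transpose, Matrix.mul_assoc,
      Matrix.diagonal_transpose]
  rw [h, frobSq_orth _ _ _ hW hV, frobSq, Finset.sum_comm]
  refine Finset.sum_congr rfl fun i _ => Finset.sum_congr rfl fun j _ => ?_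
  rw [Matrix.mul_diagonal, Matrix.diagonal_mul, Matrix.mul_apply]
  simp only [Matrix.transpose_apply]
  rw [Finset.sum_congr rfl fun k _ => mul_comm (U' k j) (U k i)]
  ring

lemma tendsto_ridge (s : ℝ) :
    Filter.Tendsto (fun κ : ℝ => κ * (s / (s + κ))) Filter.atTop (nhds s) := by
  have h1 : Filter.Tendsto (fun κ : ℝ => s - s ^ 2 * (s + κ)⁻¹) Filter.atTop
      (nhds (s - s ^ 2 * 0)) :=
    ((tendsto_inv_atTop_zero.comp (Filter.tendsto_atTop_add_const_left _ s
      Filter.tendsto_id)).const_mul _).const_sub _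
  rw [mul_zero, sub_zero] at h1
  refine h1.congr' ?_
  filter_upwards [Filter.eventually_gt_atTop (-s)] with κ hκ
  have : s + κ ≠ 0 := by linarith
  field_simp
  ring

lemma sum_pos_of_ne {n p : ℕ} (X U : Matrix (Fin n) (Fin p) ℝ) (σ : Fin p → ℝ)
    (V : Matrix (Fin p) (Fin p) ℝ) (hX : X ≠ 0) (h : X = U * Matrix.diagonal σ * Vᵀ) :
    0 < ∑ i, (σ i ^ 2) ^ 2 := by
  have hs : ∃ i, σ i ≠ 0 := by
    by_contra! hc
    have : σ = 0 := funext hc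
    subst this
    apply hX
    rw [h, Matrix.diagonal_zero', Matrix.mul_zero, Matrix.zero_mul]
  obtain ⟨i, hi⟩ := hs
  exact Finset.sum_pos' (fun _ _ => by positivity) ⟨i, Finset.mem_univ _, by positivity⟩

lemma tendsto_den {p : ℕ} (σ : Fin p → ℝ) :
    Filter.Tendsto (fun κ : ℝ => κ * Real.sqrt (∑ i, (σ i ^ 2 / (σ i ^ 2 + κ)) ^ 2))
      Filter.atTop (nhds (Real.sqrt (∑ i, (σ i ^ 2) ^ 2))) := by
  have h := (tendsto_finsetSum Finset.univ
    (fun i (_ : i ∈ Finset.univ) => (tendsto_ridge (σ i ^ 2)).pow 2)).sqrt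
  refine h.congr' ?_
  filter_upwards [Filter.eventually_ge_atTop 0] with κ hκ
  simp only [mul_pow _ _ 2, ← Finset.mul_sum]
  rw [Real.sqrt_mul (by positivity), Real.sqrt_sq hκ]

theorem canonical_ridge_limit_cka (n p₁ p₂ : ℕ)
    (X : Matrix (Fin n) (Fin p₁) ℝ) (Y : Matrix (Fin n) (Fin p₂) ℝ)
    (hXne : X ≠ 0) (hYne : Y ≠ 0)
    (UX : Matrix (Fin n) (Fin p₁) ℝ) (σX : Fin p₁ → ℝ) (VX : Matrix (Fin p₁) (Fin p₁) ℝ)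
    (UY : Matrix (Fin n) (Fin p₂) ℝ) (σY : Fin p₂ → ℝ) (VY : Matrix (Fin p₂) (Fin p₂) ℝ)
    (hUX : UXᵀ * UX = 1) (hUY : UYᵀ * UY = 1)
    (hVX : VXᵀ * VX = 1) (hVY : VYᵀ * VY = 1)
    (hσX : ∀ i, 0 ≤ σX i) (hσY : ∀ j, 0 ≤ σY j)
    (hSVDX : X = UX * Matrix.diagonal σX * VXᵀ)
    (hSVDY : Y = UY * Matrix.diagonal σY * VYᵀ) :
    Filter.Tendsto (fun κ : ℝ =>
        (∑ i : Fin p₁, ∑ j : Fin p₂,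
            σX i ^ 2 * σY j ^ 2 / ((σX i ^ 2 + κ) * (σY j ^ 2 + κ)) *
              (∑ k, UX k i * UY k j) ^ 2) /
          (Real.sqrt (∑ i : Fin p₁, (σX i ^ 2 / (σX i ^ 2 + κ)) ^ 2) *
            Real.sqrt (∑ j : Fin p₂, (σY j ^ 2 / (σY j ^ 2 + κ)) ^ 2)))
      Filter.atTop
      (nhds ((∑ i : Fin p₁, ∑ j : Fin p₂,
          σX i ^ 2 * σY j ^ 2 * (∑ k, UX k i * UY k j) ^ 2) /
        (Real.sqrt (∑ i : Fin p₁, (σX i ^ 2) ^ 2) *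
          Real.sqrt (∑ j : Fin p₂, (σY j ^ 2) ^ 2)))) ∧
    (∑ i : Fin p₁, ∑ j : Fin p₂, σX i ^ 2 * σY j ^ 2 * (∑ k, UX k i * UY k j) ^ 2) /
        (Real.sqrt (∑ i : Fin p₁, (σX i ^ 2) ^ 2) *
          Real.sqrt (∑ j : Fin p₂, (σY j ^ 2) ^ 2)) =
      frobSq (Yᵀ * X) / (frobNorm (Xᵀ * X) * frobNorm (Yᵀ * Y)) := by
  constructor
  · have hpX := sum_pos_of_ne X UX σX VX hXne hSVDX
    have hpY := sum_pos_of_ne Y UY σY VY hYne hSVDY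
    have hN := tendsto_finsetSum Finset.univ (fun i (_ : i ∈ Finset.univ) =>
      tendsto_finsetSum Finset.univ (fun j (_ : j ∈ Finset.univ) =>
        ((tendsto_ridge (σX i ^ 2)).mul (tendsto_ridge (σY j ^ 2))).mul_const
          ((∑ k, UX k i * UY k j) ^ 2)))
    have hD := (tendsto_den σX).mul (tendsto_den σY)
    have h := hN.div hD (mul_pos (Real.sqrt_pos.2 hpX) (Real.sqrt_pos.2 hpY)).ne'
    refine h.congr' ?_
    filter_upwards [Filter.eventually_gt_atTop 0] with κ hκ
    have e : (∑ i, ∑ j, κ * (σX i ^ 2 / (σX i ^ 2 + κ)) * (κ * (σY j ^ 2 / (σY j ^ 2 + κ))) *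
          (∑ k, UX k i * UY k j) ^ 2)
        = (κ * κ) * ∑ i, ∑ j, σX i ^ 2 * σY j ^ 2 / ((σX i ^ 2 + κ) * (σY j ^ 2 + κ)) *
              (∑ k, UX k i * UY k j) ^ 2 := by
      simp only [Finset.mul_sum _ _ (κ * κ)]
      refine Finset.sum_congr rfl fun i _ => Finset.sum_congr rfl fun j _ => ?_
      rw [mul_div_mul_comm]
      ring
    simp only [Pi.div_apply]
    rw [e, mul_mul_mul_comm, mul_div_mul_left _ _ (mul_pos hκ hκ).ne']
  · subst hSVDX hSVDY
    rw [frobNorm, frobNorm, frobSq_gram _ _ _ hUX hVX, frobSq_gram _ _ _ hUY hVY,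
      frobSq_cross _ _ _ hVX _ _ _ hVY]
end

section
/- With X, Y, κ_X, κ_Y, Q̃_X, Q̃_Y, λ_X^i, λ_Y^j, u_X^i, u_Y^j as in the canonical ridge setting, and assuming X ≠ 0 and Y ≠ 0, the quantity [Σ_{i=1}^{p₁} Σ_{j=1}^{p₂} (λ_X^i·λ_Y^j/((λ_X^i + κ_X)·(λ_Y^j + κ_Y)))·⟨u_X^i, u_Y^j⟩²] / [√(Σ_{i=1}^{p₁} (λ_X^i/(λ_X^i + κ_X))²)·√(Σ_{j=1}^{p₂} (λ_Y^j/(λ_Y^j + κ_Y))²)] equals ‖Q̃_Yᵀ·Q̃_X‖_F²/(‖Q̃_Xᵀ·Q̃_X‖_F·‖Q̃_Yᵀ·Q̃_Y‖_F) = CKA(Q̃_X·Q̃_Xᵀ, Q̃_Y·Q̃_Yᵀ). -/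
open Matrix

theorem ridge_entry {n p : ℕ} (U : Matrix (Fin n) (Fin p) ℝ) (σ : Fin p → ℝ) (κ : ℝ)
    (k : Fin n) (i : Fin p) :
    (U * Matrix.diagonal σ * Matrix.diagonal (fun i => (Real.sqrt (σ i ^ 2 + κ))⁻¹)) k i
      = U k i * (σ i * (Real.sqrt (σ i ^ 2 + κ))⁻¹) := by
  rw [Matrix.mul_diagonal, Matrix.mul_diagonal, mul_assoc]

theorem ridge_sq (s κ : ℝ) (hκ : 0 < κ) :
    (s * (Real.sqrt (s ^ 2 + κ))⁻¹) ^ 2 = s ^ 2 / (s ^ 2 + κ) := by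
  rw [mul_pow, inv_pow, Real.sq_sqrt (by positivity), div_eq_mul_inv]

theorem ridge_self {n p : ℕ} (U : Matrix (Fin n) (Fin p) ℝ) (σ : Fin p → ℝ) (κ : ℝ)
    (hκ : 0 < κ) (hU : Uᵀ * U = 1) (Q : Matrix (Fin n) (Fin p) ℝ)
    (hQ : Q = U * Matrix.diagonal σ * Matrix.diagonal (fun i => (Real.sqrt (σ i ^ 2 + κ))⁻¹)) :
    frobSq (Qᵀ * Q) = ∑ i, (σ i ^ 2 / (σ i ^ 2 + κ)) ^ 2 := by
  have key : Qᵀ * Q = Matrix.diagonal (fun i => σ i ^ 2 / (σ i ^ 2 + κ)) := by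
    ext i j
    have h1 : (Qᵀ * Q) i j = (σ i * (Real.sqrt (σ i ^ 2 + κ))⁻¹) *
        (σ j * (Real.sqrt (σ j ^ 2 + κ))⁻¹) * (Uᵀ * U) i j := by
      simp only [Matrix.mul_apply (M := Qᵀ), Matrix.mul_apply (M := Uᵀ), Matrix.transpose_apply,
        Finset.mul_sum]
      refine Finset.sum_congr rfl fun k _ => ?_
      rw [hQ, ridge_entry, ridge_entry]
      ring
    rw [h1, hU]
    by_cases hij : i = j
    · subst hij
      rw [Matrix.one_apply_eq, Matrix.diagonal_apply_eq, mul_one, ← sq, ridge_sq _ _ hκ]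
    · rw [Matrix.one_apply_ne hij, Matrix.diagonal_apply_ne _ hij, mul_zero]
  rw [key, frobSq]
  refine Finset.sum_congr rfl fun i _ => ?_
  rw [Finset.sum_eq_single i]
  · rw [Matrix.diagonal_apply_eq]
  · intro j _ hj
    rw [Matrix.diagonal_apply_ne _ hj.symm]
    norm_num
  · simp

theorem canonical_ridge_normalized_is_cka (n p₁ p₂ : ℕ)
    (X : Matrix (Fin n) (Fin p₁) ℝ) (Y : Matrix (Fin n) (Fin p₂) ℝ)
    (hXne : X ≠ 0) (hYne : Y ≠ 0)
    (UX : Matrix (Fin n) (Fin p₁) ℝ) (σX : Fin p₁ → ℝ) (VX : Matrix (Fin p₁) (Fin p₁) ℝ)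
    (UY : Matrix (Fin n) (Fin p₂) ℝ) (σY : Fin p₂ → ℝ) (VY : Matrix (Fin p₂) (Fin p₂) ℝ)
    (hUX : UXᵀ * UX = 1) (hUY : UYᵀ * UY = 1)
    (hVX : VXᵀ * VX = 1) (hVY : VYᵀ * VY = 1)
    (hσX : ∀ i, 0 ≤ σX i) (hσY : ∀ j, 0 ≤ σY j)
    (hSVDX : X = UX * Matrix.diagonal σX * VXᵀ)
    (hSVDY : Y = UY * Matrix.diagonal σY * VYᵀ)
    (κX κY : ℝ) (hκX : 0 < κX) (hκY : 0 < κY)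
    (QtX : Matrix (Fin n) (Fin p₁) ℝ) (QtY : Matrix (Fin n) (Fin p₂) ℝ)
    (hQtX : QtX = UX * Matrix.diagonal σX *
      Matrix.diagonal (fun i => (Real.sqrt (σX i ^ 2 + κX))⁻¹))
    (hQtY : QtY = UY * Matrix.diagonal σY *
      Matrix.diagonal (fun j => (Real.sqrt (σY j ^ 2 + κY))⁻¹)) :
    (∑ i : Fin p₁, ∑ j : Fin p₂,
        σX i ^ 2 * σY j ^ 2 / ((σX i ^ 2 + κX) * (σY j ^ 2 + κY)) *
          (∑ k, UX k i * UY k j) ^ 2) /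
      (Real.sqrt (∑ i : Fin p₁, (σX i ^ 2 / (σX i ^ 2 + κX)) ^ 2) *
        Real.sqrt (∑ j : Fin p₂, (σY j ^ 2 / (σY j ^ 2 + κY)) ^ 2)) =
    frobSq (QtYᵀ * QtX) / (frobNorm (QtXᵀ * QtX) * frobNorm (QtYᵀ * QtY)) := by
  rw [frobNorm, frobNorm, ridge_self UX σX κX hκX hUX QtX hQtX,
    ridge_self UY σY κY hκY hUY QtY hQtY]
  congr 1
  rw [frobSq, Finset.sum_comm]
  refine Finset.sum_congr rfl fun j _ => Finset.sum_congr rfl fun i _ => ?_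
  have h1 : (QtYᵀ * QtX) j i = (σX i * (Real.sqrt (σX i ^ 2 + κX))⁻¹) *
      (σY j * (Real.sqrt (σY j ^ 2 + κY))⁻¹) * ∑ k, UX k i * UY k j := by
    simp only [Matrix.mul_apply (M := QtYᵀ), Matrix.transpose_apply, Finset.mul_sum]
    refine Finset.sum_congr rfl fun k _ => ?_
    rw [hQtX, hQtY, ridge_entry, ridge_entry]
    ring
  rw [h1, mul_pow, mul_pow, ridge_sq _ _ hκX, ridge_sq _ _ hκY, div_mul_div_comm]
end

section
/- Let X and Y be n×p real matrices and suppose Xᵀ·Y = U·Σ·Vᵀ is a singular value decomposition, with U and V orthogonal p×p real matrices and Σ a diagonal p×p matrix with nonnegative diagonal entries. Then for every p×p orthogonal matrix Q, tr(Yᵀ·X·Q) ≤ tr(Σ), and equality holds for Q̂ = U·Vᵀ, i.e. tr(Yᵀ·X·U·Vᵀ) = tr(Σ). Hence Q̂ = U·Vᵀ solves the orthogonal Procrustes problem, and the maximal value tr(Σ) is the sum of the singular values (nuclear norm) of Yᵀ·X. -/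
open Matrix

theorem procrustes_solution (n p : ℕ)
    (X Y : Matrix (Fin n) (Fin p) ℝ)
    (U V : Matrix (Fin p) (Fin p) ℝ) (σ : Fin p → ℝ)
    (hU : Uᵀ * U = 1) (hV : Vᵀ * V = 1) (hσ : ∀ i, 0 ≤ σ i)
    (hSVD : Xᵀ * Y = U * Matrix.diagonal σ * Vᵀ) :
    (∀ Q : Matrix (Fin p) (Fin p) ℝ, Qᵀ * Q = 1 →
      Matrix.trace (Yᵀ * X * Q) ≤ Matrix.trace (Matrix.diagonal σ)) ∧
    Matrix.trace (Yᵀ * X * (U * Vᵀ)) = Matrix.trace (Matrix.diagonal σ) := by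
  have hYX : Yᵀ * X = V * Matrix.diagonal σ * Uᵀ := by
    have h := congrArg Matrix.transpose hSVD
    simpa [Matrix.transpose_mul, Matrix.mul_assoc] using h
  have key : ∀ Q : Matrix (Fin p) (Fin p) ℝ,
      Matrix.trace (Yᵀ * X * Q) = Matrix.trace (Matrix.diagonal σ * (Uᵀ * Q * V)) := by
    intro Q
    rw [hYX, Matrix.mul_assoc V, Matrix.mul_assoc V, Matrix.trace_mul_comm V]
    simp only [Matrix.mul_assoc]
  constructor
  · intro Q hQ
    rw [key]
    have hU' : U * Uᵀ = 1 := mul_eq_one_comm.mp hU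
    have hW : (Uᵀ * Q * V)ᵀ * (Uᵀ * Q * V) = 1 := by
      calc (Uᵀ * Q * V)ᵀ * (Uᵀ * Q * V) = Vᵀ * (Qᵀ * (U * Uᵀ) * Q) * V := by
            simp only [Matrix.transpose_mul, Matrix.transpose_transpose, Matrix.mul_assoc]
        _ = 1 := by rw [hU', Matrix.mul_one, hQ, Matrix.mul_one, hV]
    generalize Uᵀ * Q * V = W at hW
    have hle : ∀ i, W i i ≤ 1 := by
      intro i
      have h1 : ∑ j, W j i * W j i = 1 := by
        have h := congrFun (congrFun hW i) i
        simpa [Matrix.mul_apply] using h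
      have h2 : W i i * W i i ≤ ∑ j, W j i * W j i :=
        Finset.single_le_sum (f := fun j => W j i * W j i)
          (fun j _ => mul_self_nonneg _) (Finset.mem_univ i)
      nlinarith
    simp only [Matrix.trace, Matrix.diag_apply, Matrix.diagonal_mul, Matrix.diagonal_apply_eq]
    exact Finset.sum_le_sum fun i _ => mul_le_of_le_one_right (hσ i) (hle i)
  · rw [key, ← Matrix.mul_assoc Uᵀ, hU, Matrix.one_mul, hV, Matrix.mul_one]
end
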